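/- Let H ∈ (1/2, 1) and c_H = H(2H−1). Suppose that for every T > 0 there is a continuous function g_T : [0,T] → ℝ satisfying g_T(s) + c_H ∫₀^T |s−r|^{2H−2} g_T(r) dr = 1 for all s ∈ [0,T], and that this continuous solution is unique. Then there exists a constant κ_H ∈ (0, ∞) such that T^{2H−1} · g_T(T)² → κ_H as T → ∞; in particular g_T(T)² is asymptotically proportional to T^{1−2H}. -/

import Mathlib

open MeasureTheory Real Set Filter

noncomputable def kk (b x : ℝ) : ℝ := |x| ^ (b - 1)
noncomputable def PP (b x : ℝ) : ℝ := ∫ y in (0:ℝ)..x, kk b y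

lemma kk_neg (b x : ℝ) : kk b (-x) = kk b x := by simp [kk]
lemma kk_nonneg (b x : ℝ) : 0 ≤ kk b x := by unfold kk; positivity
lemma kk_meas (b : ℝ) : Measurable (kk b) := by unfold kk; fun_prop
lemma kk_mul (b x y : ℝ) : kk b (x * y) = kk b x * kk b y := by
  unfold kk; rw [abs_mul, Real.mul_rpow (abs_nonneg _) (abs_nonneg _)]
lemma kk_anti {b : ℝ} (hb : b < 1) {x y : ℝ} (hx : x ≠ 0) (h : |x| ≤ |y|) : kk b y ≤ kk b x := by
  unfold kk
  exact Real.rpow_le_rpow_of_nonpos (abs_pos.2 hx) h (by linarith)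

lemma kk_ii {b : ℝ} (hb : 0 < b) (a c : ℝ) : IntervalIntegrable (kk b) volume a c := by
  apply intervalIntegrable_of_even (fun x => (kk_neg b x).symm)
  intro t ht
  refine (intervalIntegral.intervalIntegrable_rpow' (r := b - 1) (by linarith)).congr ?_
  intro x hx
  rw [uIoc_of_le ht.le] at hx
  simp [kk, abs_of_pos hx.1]

lemma PP_pos {b : ℝ} (hb : 0 < b) {x : ℝ} (hx : 0 ≤ x) : PP b x = x ^ b / b := by
  unfold PP
  have : ∫ y in (0:ℝ)..x, kk b y = ∫ y in (0:ℝ)..x, y ^ (b - 1) := by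
    apply intervalIntegral.integral_congr
    intro y hy
    rw [uIcc_of_le hx] at hy
    simp [kk, abs_of_nonneg hy.1]
  rw [this, integral_rpow (Or.inl (by linarith))]
  simp [hb.ne']

lemma PP_neg (b x : ℝ) : PP b (-x) = - PP b x := by
  unfold PP
  have := intervalIntegral.integral_comp_neg (a := 0) (b := x) (f := kk b)
  simp only [kk_neg, neg_zero] at this
  rw [this, intervalIntegral.integral_symm]

lemma kk_integral {b : ℝ} (hb : 0 < b) (a c : ℝ) : ∫ y in a..c, kk b y = PP b c - PP b a := by
  unfold PP
  rw [intervalIntegral.integral_interval_sub_left (kk_ii hb _ _) (kk_ii hb _ _)]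

lemma PP_mono {b : ℝ} (hb : 0 < b) : Monotone (PP b) := by
  intro x y h
  have := intervalIntegral.integral_nonneg (μ := volume) h (fun u _ => kk_nonneg b u)
  rw [kk_integral hb] at this
  linarith

lemma rpow_subadd {b : ℝ} (hb : 0 < b) (hb1 : b < 1) {x y : ℝ} (hx : 0 ≤ x) (hy : 0 ≤ y) :
    (x + y) ^ b ≤ x ^ b + y ^ b := by
  have := NNReal.rpow_add_le_add_rpow ⟨x, hx⟩ ⟨y, hy⟩ hb.le hb1.le
  exact_mod_cast this

/-- D -/
noncomputable def DD (b M : ℝ) : ℝ := 2 * PP b M - PP b (M + 1) + PP b (1 - M)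

lemma DD_nonneg {b : ℝ} (hb : 0 < b) (hb1 : b < 1) {M : ℝ} (hM : 0 ≤ M) : 0 ≤ DD b M := by
  unfold DD
  rw [PP_pos hb hM, PP_pos hb (by linarith : (0:ℝ) ≤ M + 1)]
  rcases le_total M 1 with h | h
  · rw [PP_pos hb (by linarith : (0:ℝ) ≤ 1 - M)]
    have h1 := rpow_subadd hb hb1 hM (zero_le_one)
    have h2 := rpow_subadd hb hb1 hM (by linarith : (0:ℝ) ≤ 1 - M)
    rw [add_sub_cancel, Real.one_rpow] at h2
    rw [Real.one_rpow] at h1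
    have : 0 ≤ (2 * M ^ b - (M+1)^b + (1 - M)^b) / b := div_nonneg (by linarith) hb.le
    convert this using 1; ring
  · rw [show 1 - M = -(M - 1) by ring, PP_neg, PP_pos hb (by linarith : (0:ℝ) ≤ M - 1)]
    have hc := (Real.concaveOn_rpow hb.le hb1.le).2
    have h1 := @hc (M + 1) (by simp; linarith) (M - 1)
      (by simp; linarith) (1/2) (1/2) (by norm_num) (by norm_num) (by norm_num)
    simp only [smul_eq_mul] at h1
    rw [show 1/2 * (M+1) + 1/2 * (M - 1) = M by ring] at h1
    have : 0 ≤ (2 * M ^ b - (M+1)^b - (M - 1)^b) / b := div_nonneg (by linarith) hb.le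
    convert this using 1; ring

lemma DD_le {b : ℝ} (hb : 0 < b) (hb1 : b < 1) {M : ℝ} (hM : 1 < M) : DD b M ≤ (M - 1) ^ (b - 1) := by
  unfold DD
  have h0 : 0 < M - 1 := by linarith
  rw [show 1 - M = -(M - 1) by ring, PP_neg]
  have h1 := PP_mono hb (by linarith : M ≤ M + 1)
  have h2 := _root_.rpow_one_add_le_one_add_mul_self (s := 1 / (M - 1)) (p := b)
    (by have : 0 < 1 / (M - 1) := by positivity
        linarith) hb.le hb1.le
  have h3 : (M - 1)^b * (1 + 1/(M-1))^b = M ^ b := by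
    rw [← Real.mul_rpow h0.le (by positivity)]; congr 1; field_simp; ring
  have h4 : M ^ b ≤ (M-1)^b + b * (M - 1)^(b - 1) := by
    rw [← h3, Real.rpow_sub_one h0.ne']
    calc _ ≤ (M - 1)^b * (1 + b * (1/(M-1))) := by gcongr
      _ = _ := by ring
  have h5 : PP b M - PP b (M-1) ≤ (M - 1) ^ (b - 1) := by
    rw [PP_pos hb (by linarith : (0:ℝ) ≤ M), PP_pos hb h0.le, ← sub_div, div_le_iff₀ hb]
    linarith
  linarith

lemma DD_tendsto {b : ℝ} (hb : 0 < b) (hb1 : b < 1) {η : ℝ} (hη : 0 < η) :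
    ∃ M0 : ℝ, 0 < M0 ∧ ∀ M, M0 ≤ M → DD b M ≤ η := by
  have h1 : Tendsto (fun M : ℝ => (M - 1) ^ (-(1 - b))) atTop (nhds 0) :=
    (tendsto_rpow_neg_atTop (by linarith : 0 < 1 - b)).comp (tendsto_atTop_add_const_right _ (-1) tendsto_id)
  have h2 := h1.eventually_le_const hη
  obtain ⟨A, hA⟩ := eventually_atTop.1 h2
  refine ⟨max A 2, by positivity, fun M hM => ?_⟩
  have := hA M (le_trans (le_max_left _ _) hM)
  have h3 : 2 ≤ M := le_trans (le_max_right _ _) hM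
  refine (DD_le hb hb1 (by linarith)).trans ?_
  rwa [show b - 1 = -(1-b) by ring]

/-- the inner integral -/
lemma psi_eq {b : ℝ} (hb : 0 < b) {N x : ℝ} (hx : x ≠ 0) :
    ∫ w in (-N)..N, (kk b x * kk b w - kk b (x + 1 / w) * kk b w) = DD b (N * |x|) / |x| := by
  have h1 : ∫ w in (-N)..N, (kk b x * kk b w - kk b (x + 1 / w) * kk b w)
      = ∫ w in (-N)..N, (fun v => kk b v - kk b (v + 1)) (x * w) := by
    apply intervalIntegral.integral_congr_ae
    have : ∀ᵐ w : ℝ, w ≠ 0 := by simp [ae_iff]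
    filter_upwards [this] with w hw _
    show _ = kk b (x * w) - kk b (x * w + 1)
    rw [← kk_mul, ← kk_mul]
    congr 2
    field_simp
  have h2 : ∀ M : ℝ, ∫ v in (-M)..M, (kk b v - kk b (v + 1)) = DD b M := by
    intro M
    rw [intervalIntegral.integral_sub (kk_ii hb _ _)]
    · rw [kk_integral hb, intervalIntegral.integral_comp_add_right (fun v => kk b v), kk_integral hb, PP_neg]
      unfold DD
      rw [show -M + 1 = 1 - M by ring]; ring
    · simpa using (kk_ii hb (-M + 1) (M + 1)).comp_add_right 1
  rw [h1, eq_div_iff (abs_pos.2 hx).ne']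
  have h3 := intervalIntegral.mul_integral_comp_mul_left (a := -N) (b := N) (f := fun v => kk b v - kk b (v + 1)) x
  rcases lt_or_gt_of_ne hx with h | h
  · rw [abs_of_neg h, ← h2, mul_comm, neg_mul, h3, intervalIntegral.integral_symm]
    simp only [neg_neg]
    congr 1 <;> ring
  · rw [abs_of_pos h, ← h2, mul_comm, h3]
    congr 1 <;> ring

noncomputable def KK (b : ℝ) (f : ℝ → ℝ) (x : ℝ) : ℝ := ∫ y, kk b (x - y) * f y

structure Nice (L M : ℝ) (f : ℝ → ℝ) : Prop where
  meas : AEStronglyMeasurable f volume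
  bd : ∀ y, |f y| ≤ M
  supp : ∀ y, y ∉ Icc 0 L → f y = 0
  L0 : 0 ≤ L

lemma Nice.M0 {L M : ℝ} {f : ℝ → ℝ} (h : Nice L M f) : 0 ≤ M := (abs_nonneg _).trans (h.bd 0)

lemma kk_sub_ii {b : ℝ} (hb : 0 < b) (x a c : ℝ) : IntervalIntegrable (fun y => kk b (x - y)) volume a c := by
  simpa using ((kk_ii hb (x - a) (x - c)).comp_sub_left x)

lemma kk_sub_integral {b : ℝ} (hb : 0 < b) (x a c : ℝ) :
    ∫ y in a..c, kk b (x - y) = PP b (x - a) - PP b (x - c) := by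
  rw [intervalIntegral.integral_comp_sub_left (fun y => kk b y), kk_integral hb]

lemma Nice.integrable {b L M : ℝ} {f : ℝ → ℝ} (hb : 0 < b) (h : Nice L M f) (x : ℝ) :
    Integrable (fun y => kk b (x - y) * f y) := by
  have h1 : IntegrableOn (fun y => kk b (x - y)) (Icc 0 L) := by
    rw [integrableOn_Icc_iff_integrableOn_Ioc, ← intervalIntegrable_iff_integrableOn_Ioc_of_le h.L0]
    exact kk_sub_ii hb x 0 L
  have h2 : IntegrableOn (fun y => kk b (x - y) * f y) (Icc 0 L) := by
    have := Integrable.bdd_mul (c := M) h1 h.meas.restrict (ae_of_all _ (fun y => h.bd y))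
    simpa only [IntegrableOn, mul_comm] using this
  refine (integrableOn_iff_integrable_of_support_subset ?_).1 h2
  intro y hy
  by_contra hc
  exact hy (by simp [h.supp y hc])

lemma Nice.abs {L M : ℝ} {f : ℝ → ℝ} (h : Nice L M f) : Nice L M (fun y => |f y|) :=
  ⟨h.meas.norm, by simpa using h.bd, fun y hy => by simp [h.supp y hy], h.L0⟩

lemma kk_diff {b : ℝ} (hb : 0 < b) (hb1 : b < 1) {x x' : ℝ} (hx : x < x') {a c : ℝ}
    (ha : a ≤ (x + x')/2) (hc : (x+x')/2 ≤ c) :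
    ∫ y in a..c, |kk b (x - y) - kk b (x' - y)| ≤ 4 * ((x' - x) ^ b / b) := by
  set m := (x + x')/2 with hm
  have hii : ∀ p q, IntervalIntegrable (fun y => kk b (x - y) - kk b (x' - y)) volume p q :=
    fun p q => (kk_sub_ii hb x p q).sub (kk_sub_ii hb x' p q)
  have hae : ∀ᵐ y : ℝ, y ≠ x ∧ y ≠ x' := by
    have h1 : ∀ᵐ w : ℝ, w ≠ x := by simp [ae_iff]
    have h2 : ∀ᵐ w : ℝ, w ≠ x' := by simp [ae_iff]
    filter_upwards [h1, h2] with y h1 h2 using ⟨h1, h2⟩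
  rw [← intervalIntegral.integral_add_adjacent_intervals (hii a m).abs (hii m c).abs]
  have e1 : ∫ y in a..m, |kk b (x - y) - kk b (x' - y)| = ∫ y in a..m, (kk b (x - y) - kk b (x' - y)) := by
    apply intervalIntegral.integral_congr_ae
    filter_upwards [hae] with y hy hy2
    rw [uIoc_of_le ha] at hy2
    apply abs_of_nonneg
    rw [sub_nonneg]
    apply kk_anti hb1 (sub_ne_zero.2 hy.1.symm)
    rw [abs_of_pos (by linarith [hy2.2] : 0 < x' - y), abs_le]
    constructor <;> linarith [hy2.2]
  have e2 : ∫ y in m..c, |kk b (x - y) - kk b (x' - y)| = ∫ y in m..c, (kk b (x' - y) - kk b (x - y)) := by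
    apply intervalIntegral.integral_congr_ae
    filter_upwards [hae] with y hy hy2
    rw [uIoc_of_le hc] at hy2
    rw [abs_sub_comm]
    apply abs_of_nonneg
    rw [sub_nonneg]
    apply kk_anti hb1 (sub_ne_zero.2 hy.2.symm)
    rw [abs_of_neg (by linarith [hy2.1] : x - y < 0), abs_le]
    constructor <;> linarith [hy2.1]
  rw [e1, e2, intervalIntegral.integral_sub (kk_sub_ii hb _ _ _) (kk_sub_ii hb _ _ _),
    intervalIntegral.integral_sub (kk_sub_ii hb _ _ _) (kk_sub_ii hb _ _ _)]
  simp only [kk_sub_integral hb]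
  rw [← PP_pos hb (by linarith : 0 ≤ x' - x)]
  have n1 : PP b (x - m) = - PP b (x' - m) := by rw [← PP_neg]; congr 1; linarith
  have m1 := PP_mono hb (by linarith : x' - m ≤ x' - x)
  have m2 := PP_mono hb (by linarith : x - a ≤ x' - a)
  have m3 := PP_mono hb (by linarith : x - c ≤ x' - c)
  linarith

lemma Nice.holder' {b L M : ℝ} {f : ℝ → ℝ} (hb : 0 < b) (hb1 : b < 1) (h : Nice L M f) {x x' : ℝ}
    (hx : x < x') : |KK b f x - KK b f x'| ≤ 4 * M / b * |x - x'| ^ b := by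
  unfold KK
  rw [← integral_sub (h.integrable hb x) (h.integrable hb x')]
  set a := min 0 ((x+x')/2)
  set c := max L ((x+x')/2)
  have hac : a ≤ c := (min_le_left _ _).trans (h.L0.trans (le_max_left _ _))
  have hii : IntervalIntegrable (fun y => kk b (x - y) - kk b (x' - y)) volume a c :=
    (kk_sub_ii hb x a c).sub (kk_sub_ii hb x' a c)
  have hint : IntegrableOn (fun y => |kk b (x - y) - kk b (x' - y)|) (Ioc a c) :=
    (intervalIntegrable_iff_integrableOn_Ioc_of_le hac).1 hii.abs
  rw [← integrableOn_Icc_iff_integrableOn_Ioc] at hint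
  have h1 : |∫ y, (kk b (x - y) * f y - kk b (x' - y) * f y)| ≤
      ∫ y, (Icc a c).indicator (fun y => |kk b (x - y) - kk b (x' - y)| * M) y := by
    rw [← Real.norm_eq_abs]
    apply norm_integral_le_of_norm_le
    · exact IntegrableOn.integrable_indicator (Integrable.mul_const hint M) measurableSet_Icc
    · refine ae_of_all _ fun y => ?_
      rw [← sub_mul, Real.norm_eq_abs, abs_mul]
      by_cases hy : y ∈ Icc a c
      · rw [indicator_of_mem hy]
        exact mul_le_mul_of_nonneg_left (h.bd y) (abs_nonneg _)
      · rw [indicator_of_notMem hy, h.supp y]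
        · simp
        · intro h3
          exact hy ⟨(min_le_left _ _).trans h3.1, h3.2.trans (le_max_left _ _)⟩
  rw [integral_indicator measurableSet_Icc, integral_Icc_eq_integral_Ioc,
    ← intervalIntegral.integral_of_le hac, intervalIntegral.integral_mul_const] at h1
  have h2 := kk_diff hb hb1 hx (min_le_right 0 ((x+x')/2)) (le_max_right L ((x+x')/2))
  refine h1.trans ((mul_le_mul_of_nonneg_right h2 h.M0).trans (le_of_eq ?_))
  rw [abs_of_neg (by linarith : x - x' < 0), neg_sub]; ring

lemma Nice.holder {b L M : ℝ} {f : ℝ → ℝ} (hb : 0 < b) (hb1 : b < 1) (h : Nice L M f) (x x' : ℝ) :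
    |KK b f x - KK b f x'| ≤ 4 * M / b * |x - x'| ^ b := by
  rcases lt_trichotomy x x' with h1 | h1 | h1
  · exact h.holder' hb hb1 h1
  · simp [h1, Real.zero_rpow hb.ne']
  · rw [abs_sub_comm, abs_sub_comm x]; exact h.holder' hb hb1 h1

lemma Nice.cont {b L M : ℝ} {f : ℝ → ℝ} (hb : 0 < b) (hb1 : b < 1) (h : Nice L M f) :
    Continuous (KK b f) := by
  rw [continuous_iff_continuousAt]
  intro x
  rw [ContinuousAt, tendsto_iff_norm_sub_tendsto_zero]
  have h2 : Tendsto (fun e => 4 * M / b * |e - x| ^ b) (nhds x) (nhds (4 * M / b * |x - x| ^ b)) := by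
    have : Continuous (fun e => 4 * M / b * |e - x| ^ b) := by
      have := Real.continuous_rpow_const hb.le
      fun_prop (disch := exact hb.le)
    exact this.tendsto x
  simp only [sub_self, abs_zero, Real.zero_rpow hb.ne', mul_zero] at h2
  exact squeeze_zero (fun _ => norm_nonneg _) (fun e => h.holder hb hb1 e x) h2

lemma Nice.bound {b L M : ℝ} {f : ℝ → ℝ} (hb : 0 < b) (h : Nice L M f) (x B : ℝ)
    (hB : ∫ y in (0:ℝ)..L, kk b (x - y) ≤ B) : |KK b f x| ≤ M * B := by
  unfold KK
  have hint : IntegrableOn (fun y => kk b (x - y)) (Ioc 0 L) :=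
    (intervalIntegrable_iff_integrableOn_Ioc_of_le h.L0).1 (kk_sub_ii hb _ _ _)
  rw [← integrableOn_Icc_iff_integrableOn_Ioc] at hint
  have h1 : |∫ y, kk b (x - y) * f y| ≤
      ∫ y, (Icc 0 L).indicator (fun y => kk b (x - y) * M) y := by
    rw [← Real.norm_eq_abs]
    apply norm_integral_le_of_norm_le
    · exact IntegrableOn.integrable_indicator (Integrable.mul_const hint M) measurableSet_Icc
    · refine ae_of_all _ fun y => ?_
      rw [Real.norm_eq_abs, abs_mul, abs_of_nonneg (kk_nonneg _ _)]
      by_cases hy : y ∈ Icc 0 L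
      · rw [indicator_of_mem hy]
        exact mul_le_mul_of_nonneg_left (h.bd y) (kk_nonneg _ _)
      · rw [indicator_of_notMem hy, h.supp y hy]
        simp
  rw [integral_indicator measurableSet_Icc, integral_Icc_eq_integral_Ioc,
    ← intervalIntegral.integral_of_le h.L0, intervalIntegral.integral_mul_const] at h1
  rw [mul_comm]
  exact h1.trans (mul_le_mul_of_nonneg_right hB h.M0)

lemma PP_bdd {b : ℝ} (hb : 0 < b) (hb1 : b < 1) {L : ℝ} (hL : 0 ≤ L) (x : ℝ) :
    ∫ y in (0:ℝ)..L, kk b (x - y) ≤ 2 * (L ^ b / b) := by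
  rw [kk_sub_integral hb, sub_zero]
  have hL' : 0 ≤ L ^ b / b := by positivity
  rcases le_total x 0 with h | h
  · obtain ⟨z, rfl⟩ : ∃ z, x = -z := ⟨-x, by ring⟩
    rw [PP_neg, show -z - L = -(z + L) by ring, PP_neg,
      PP_pos hb (by linarith : 0 ≤ z), PP_pos hb (by linarith : 0 ≤ z + L)]
    have := div_le_div_of_nonneg_right (rpow_subadd hb hb1 (by linarith : 0 ≤ z) hL) hb.le
    rw [add_div] at this
    linarith
  rcases le_total x L with h' | h'
  · rw [show x - L = -(L - x) by ring, PP_neg]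
    have m1 := PP_mono hb h'
    have m2 := PP_mono hb (by linarith : L - x ≤ L)
    rw [PP_pos hb hL] at m1 m2
    linarith
  · rw [PP_pos hb h, PP_pos hb (by linarith : 0 ≤ x - L)]
    have := div_le_div_of_nonneg_right (rpow_subadd hb hb1 (by linarith : 0 ≤ x - L) hL) hb.le
    rw [add_div, sub_add_cancel] at this
    linarith

lemma Nice.tendsto {b L M : ℝ} {f : ℝ → ℝ} (hb : 0 < b) (hb1 : b < 1) (h : Nice L M f) {ε : ℝ} (hε : 0 < ε) :
    ∃ R : ℝ, 0 < R ∧ ∀ x, R ≤ |x| → |KK b f x| ≤ ε := by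
  have h1 : Tendsto (fun t : ℝ => M * (L * (t - L) ^ (-(1 - b)))) atTop (nhds (M * (L * 0))) :=
    ((((tendsto_rpow_neg_atTop (by linarith : 0 < 1 - b))).comp
      (tendsto_atTop_add_const_right _ (-L) tendsto_id)).const_mul L).const_mul M
  rw [mul_zero, mul_zero] at h1
  obtain ⟨A, hA⟩ := eventually_atTop.1 (h1.eventually_le_const hε)
  refine ⟨max A (L + 1), lt_of_lt_of_le (by linarith [h.L0]) (le_max_right _ _), fun x hx => ?_⟩
  have hx1 := hA |x| ((le_max_left _ _).trans hx)
  have hx2 := (le_max_right A (L+1)).trans hx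
  refine (h.bound hb x (L * (|x| - L) ^ (-(1 - b))) ?_).trans hx1
  have : ∫ y in (0:ℝ)..L, kk b (x - y) ≤ ∫ y in (0:ℝ)..L, (|x| - L) ^ (-(1 - b)) := by
    apply intervalIntegral.integral_mono_on h.L0 (kk_sub_ii hb _ _ _) (by simp)
    intro y hy
    unfold kk
    rw [show b - 1 = -(1-b) by ring]
    apply Real.rpow_le_rpow_of_nonpos (by linarith) _ (by linarith)
    have := abs_sub_abs_le_abs_sub x y
    rw [abs_of_nonneg hy.1] at this
    linarith [hy.2]
  simpa using this

lemma mp_fubini {b L M : ℝ} {f : ℝ → ℝ} (hb : 0 < b) (hb1 : b < 1) (h : Nice L M f) (x0 : ℝ) {N : ℝ}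
    (hN : 0 < N) :
    Integrable (fun w => (KK b f x0 - KK b f (x0 + 1 / w)) * kk b w) (volume.restrict (Ioc (-N) N)) ∧
    Integrable (fun y => f y * ∫ w in (-N)..N, (kk b (x0 - y) * kk b w - kk b (x0 - y + 1 / w) * kk b w)) ∧
    ∫ w in Ioc (-N) N, (KK b f x0 - KK b f (x0 + 1 / w)) * kk b w =
      ∫ y, f y * ∫ w in (-N)..N, (kk b (x0 - y) * kk b w - kk b (x0 - y + 1 / w) * kk b w) := by
  have hNN : -N ≤ N := by linarith
  set μ := volume.restrict (Ioc (-N) N) with hμ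
  have hk : Integrable (kk b) μ := (intervalIntegrable_iff_integrableOn_Ioc_of_le hNN).1 (kk_ii hb _ _)
  let φ : ℝ → ℝ → ℝ := fun w y => (kk b (x0 - y) * f y) * kk b w - (kk b (x0 + 1 / w - y) * f y) * kk b w
  have hkm := kk_meas b
  have hA : Integrable (fun p : ℝ × ℝ => (kk b (x0 - p.2) * f p.2) * kk b p.1) (μ.prod volume) := by
    have := hk.mul_prod (h.integrable hb x0)
    simpa only [mul_comm] using this
  have hB : Integrable (fun p : ℝ × ℝ => (kk b (x0 + 1 / p.1 - p.2) * f p.2) * kk b p.1) (μ.prod volume) := by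
    rw [integrable_prod_iff]
    · constructor
      · exact ae_of_all _ fun w => (h.integrable hb (x0 + 1/w)).mul_const (kk b w)
      · have e : (fun w => ∫ y, ‖(kk b (x0 + 1 / w - y) * f y) * kk b w‖) =
            fun w => KK b (fun y => |f y|) (x0 + 1/w) * kk b w := by
          ext w
          unfold KK
          rw [← integral_mul_const]
          congr 1; ext y
          rw [norm_mul, norm_mul, Real.norm_of_nonneg (kk_nonneg _ _), Real.norm_of_nonneg (kk_nonneg _ _),
            Real.norm_eq_abs]
        simp only [e]
        refine Integrable.bdd_mul (c := M * (2 * (L ^ b / b))) hk ?_ ?_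
        · apply Measurable.aestronglyMeasurable
          exact (h.abs.cont hb hb1).measurable.comp (by fun_prop)
        · exact ae_of_all _ fun w => h.abs.bound hb _ _ (PP_bdd hb hb1 h.L0 _)
    · have hm : AEStronglyMeasurable (fun p : ℝ × ℝ => f p.2) (μ.prod volume) := h.meas.comp_snd
      refine (AEStronglyMeasurable.mul ?_ hm).mul ?_
      · apply Measurable.aestronglyMeasurable
        exact hkm.comp (by fun_prop)
      · apply Measurable.aestronglyMeasurable
        exact hkm.comp (by fun_prop)
  have hφ : Integrable (Function.uncurry φ) (μ.prod volume) := hA.sub hB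
  have hw : ∀ w, ∫ y, φ w y = (KK b f x0 - KK b f (x0 + 1 / w)) * kk b w := by
    intro w
    simp only [φ]
    rw [integral_sub ((h.integrable hb x0).mul_const _) ((h.integrable hb (x0+1/w)).mul_const _),
      integral_mul_const, integral_mul_const, sub_mul]
    rfl
  have hy : ∀ y, ∫ w, φ w y ∂μ =
      f y * ∫ w in (-N)..N, (kk b (x0 - y) * kk b w - kk b (x0 - y + 1 / w) * kk b w) := by
    intro y
    rw [intervalIntegral.integral_of_le hNN, ← integral_const_mul]
    congr 1; ext w
    simp only [φ]
    rw [show x0 + 1 / w - y = x0 - y + 1 / w by ring]; ring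
  refine ⟨?_, ?_, ?_⟩
  · simpa only [Function.uncurry_apply_pair, hw] using hφ.integral_prod_left
  · simpa only [Function.uncurry_apply_pair, hy] using hφ.integral_prod_right
  · have := integral_integral_swap hφ
    simpa only [hw, hy] using this

lemma max_principle {b L M : ℝ} {f : ℝ → ℝ} (hb : 0 < b) (hb1 : b < 1) (h : Nice L M f) (x0 : ℝ)
    (hmax : ∀ y, KK b f y ≤ KK b f x0) (hpos : 0 < KK b f x0) {r : ℝ} (hr : 0 < r)
    (hf : ∀ y, |y - x0| < r → f y ≤ 0) : False := by
  set u := KK b f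
  obtain ⟨R, hR0, hR⟩ := h.tendsto hb hb1 (half_pos hpos)
  set R' := max 1 (R + |x0|)
  have hR' : 0 < R' := lt_of_lt_of_le one_pos (le_max_left _ _)
  set w0 := 1 / R'
  have hw0 : 0 < w0 := by positivity
  have hw01 : w0 ≤ 1 := by
    rw [div_le_one hR']; exact le_max_left _ _
  have hfar : ∀ w ∈ Ioc 0 w0, u (x0 + 1 / w) ≤ u x0 / 2 := by
    intro w hw
    have h1 : R' ≤ 1 / w := by
      rw [le_div_iff₀ hw.1]
      have := (le_div_iff₀ hR').1 hw.2
      linarith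
    have h2 : R + |x0| ≤ 1 / w := (le_max_right _ _).trans h1
    refine (le_abs_self _).trans (hR _ ?_)
    have := le_abs_self (x0 + 1/w)
    have := neg_abs_le x0
    linarith
  set δ := ∫ w in Ioc 0 w0, u x0 / 2 * kk b w with hδ
  have hδ0 : 0 < δ := by
    rw [hδ, ← intervalIntegral.integral_of_le hw0.le, intervalIntegral.integral_const_mul]
    have : ∫ y in (0:ℝ)..w0, kk b y = w0 ^ b / b := PP_pos hb hw0.le
    rw [this]
    positivity
  have hlow : ∀ N, 1 ≤ N → δ ≤ ∫ w in Ioc (-N) N, (u x0 - u (x0 + 1 / w)) * kk b w := by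
    intro N hN
    have hi := (mp_fubini hb hb1 h x0 (by linarith : 0 < N)).1
    have hsub : Ioc 0 w0 ⊆ Ioc (-N) N := Ioc_subset_Ioc (by linarith) (by linarith)
    calc δ ≤ ∫ w in Ioc 0 w0, (u x0 - u (x0 + 1 / w)) * kk b w := by
          apply setIntegral_mono_on _ (IntegrableOn.mono_set hi hsub) measurableSet_Ioc
          · intro w hw
            apply mul_le_mul_of_nonneg_right _ (kk_nonneg _ _)
            linarith [hfar w hw]
          · exact ((intervalIntegrable_iff_integrableOn_Ioc_of_le hw0.le).1 (kk_ii hb _ _)).const_mul _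
      _ ≤ _ := by
          apply setIntegral_mono_set hi _ hsub.eventuallyLE
          exact ae_of_all _ fun w => mul_nonneg (by linarith [hmax (x0 + 1/w)]) (kk_nonneg _ _)
  have hM := h.M0
  have hL := h.L0
  set η := δ / 2 / ((M + 1) * (L + 1) / r)
  have hη : 0 < η := by positivity
  obtain ⟨M0, hM0, hDD⟩ := DD_tendsto hb hb1 hη
  set N := max 1 (M0 / r)
  have hN1 : 1 ≤ N := le_max_left _ _
  have hN0 : 0 < N := by linarith
  have hup : ∫ w in Ioc (-N) N, (u x0 - u (x0 + 1 / w)) * kk b w ≤ δ / 2 := by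
    obtain ⟨-, hi, he⟩ := mp_fubini hb hb1 h x0 hN0
    rw [he]
    calc _ ≤ ∫ y, (Icc 0 L).indicator (fun _ => (M + 1) * (η / r)) y := by
          apply integral_mono_ae hi
          · exact IntegrableOn.integrable_indicator continuousOn_const.integrableOn_Icc measurableSet_Icc
          · have hne : ∀ᵐ w : ℝ, w ≠ x0 := by simp [ae_iff]
            filter_upwards [hne] with y hy
            have hxy : x0 - y ≠ 0 := sub_ne_zero.2 hy.symm
            simp only [psi_eq hb hxy]
            have hD0 := DD_nonneg hb hb1 (by positivity : 0 ≤ N * |x0 - y|)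
            by_cases hyL : y ∈ Icc 0 L
            · rw [indicator_of_mem hyL]
              rcases lt_or_ge |y - x0| r with hc | hc
              · have h1 := hf y hc
                have h2 : 0 ≤ DD b (N * |x0 - y|) / |x0 - y| := by positivity
                have h3 : 0 ≤ (M + 1) * (η / r) := by positivity
                nlinarith
              · rw [abs_sub_comm] at hc
                have h1 : DD b (N * |x0 - y|) ≤ η := by
                  apply hDD
                  calc M0 = (M0 / r) * r := by field_simp
                    _ ≤ N * |x0 - y| := by
                      apply mul_le_mul (le_max_right _ _) hc hr.le hN0.le
                have h2 : DD b (N * |x0 - y|) / |x0 - y| ≤ η / r := by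
                  gcongr
                apply mul_le_mul _ h2 (by positivity) (by linarith)
                linarith [le_abs_self (f y), h.bd y]
            · rw [indicator_of_notMem hyL, h.supp y hyL]; simp
      _ = L * ((M + 1) * (η / r)) := by
          rw [integral_indicator measurableSet_Icc]
          simp [hL]
      _ ≤ (L + 1) * ((M + 1) * (η / r)) := by gcongr; linarith
      _ = δ / 2 := by
          simp only [η]; field_simp
  linarith [hlow N hN1]

/-- Consequence: if `f ≤ 0` wherever `KK f > t`, then `KK f ≤ t`. -/
lemma max_principle' {b L M : ℝ} {f : ℝ → ℝ} (hb : 0 < b) (hb1 : b < 1) (h : Nice L M f) {t : ℝ} (ht : 0 ≤ t)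
    (hf : ∀ y, t < KK b f y → f y ≤ 0) (x : ℝ) : KK b f x ≤ t := by
  by_contra hc
  push Not at hc
  have hx : 0 < KK b f x := by linarith
  have hcont := h.cont hb hb1
  obtain ⟨x0, hx0⟩ : ∃ x0, ∀ y, KK b f y ≤ KK b f x0 := by
    apply hcont.exists_forall_ge' x
    obtain ⟨R, hR0, hR⟩ := h.tendsto hb hb1 hx
    have : ∀ᶠ y : ℝ in cocompact ℝ, R ≤ |y| := (tendsto_norm_cocompact_atTop (E := ℝ)).eventually_ge_atTop R
    filter_upwards [this] with y hy
    exact (le_abs_self _).trans (hR y hy)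
  have h1 : ∀ᶠ y in nhds x0, t < KK b f y :=
    hcont.continuousAt.eventually_const_lt (lt_of_lt_of_le hc (hx0 x))
  obtain ⟨r, hr, hr2⟩ := Metric.eventually_nhds_iff.1 h1
  exact max_principle hb hb1 h x0 hx0 (lt_of_lt_of_le hx (hx0 x)) hr
    (fun y hy => hf y (hr2 (by rwa [Real.dist_eq])))

lemma Nice.int {L M : ℝ} {f : ℝ → ℝ} (h : Nice L M f) : Integrable f := by
  have h2 : IntegrableOn f (Icc 0 L) :=
    Measure.integrableOn_of_bounded (M := M) (by simp) h.meas (ae_of_all _ fun y => h.bd y)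
  refine (integrableOn_iff_integrable_of_support_subset ?_).1 h2
  intro y hy
  by_contra hc
  exact hy (h.supp y hc)

lemma Nice.int_mul {L M : ℝ} {L' M' : ℝ} {f h : ℝ → ℝ} (hf : Nice L M f) (hh : Nice L' M' h) :
    Integrable (fun s => f s * h s) :=
  Integrable.bdd_mul (c := M) hh.int hf.meas (ae_of_all _ fun y => hf.bd y)

lemma Nice.int_mul_KK {b L M : ℝ} {L' M' : ℝ} {f h : ℝ → ℝ} (hb : 0 < b) (hb1 : b < 1) (hf : Nice L M f)
    (hh : Nice L' M' h) : Integrable (fun s => f s * KK b h s) := by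
  have := Integrable.bdd_mul (c := M' * (2 * (L' ^ b / b))) hf.int
    (hh.cont hb hb1).aestronglyMeasurable (ae_of_all _ fun y => hh.bound hb y _ (PP_bdd hb hb1 hh.L0 y))
  simpa only [mul_comm] using this

lemma Nice.sub {L M L' M' : ℝ} {f h : ℝ → ℝ} (hf : Nice L M f) (hh : Nice L' M' h) (hL : L ≤ L') :
    Nice L' (M + M') (fun y => f y - h y) := by
  refine ⟨hf.meas.sub hh.meas, fun y => ?_, fun y hy => ?_, hh.L0⟩
  · exact (abs_sub _ _).trans (add_le_add (hf.bd y) (hh.bd y))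
  · rw [hh.supp y hy, hf.supp y (fun h => hy ⟨h.1, h.2.trans hL⟩)]; simp

lemma KK_sub {b L M L' M' : ℝ} {f h : ℝ → ℝ} (hb : 0 < b) (hf : Nice L M f) (hh : Nice L' M' h) (x : ℝ) :
    KK b (fun y => f y - h y) x = KK b f x - KK b h x := by
  unfold KK
  rw [← integral_sub (hf.integrable hb x) (hh.integrable hb x)]
  congr 1; ext y; ring

lemma KK_symm {b L M L' M' : ℝ} {f h : ℝ → ℝ} (hb : 0 < b) (hb1 : b < 1) (hf : Nice L M f) (hh : Nice L' M' h) :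
    ∫ s, h s * KK b f s = ∫ s, f s * KK b h s := by
  have hkm := kk_meas b
  let φ : ℝ → ℝ → ℝ := fun s r => h s * (kk b (s - r) * f r)
  have hφ : Integrable (Function.uncurry φ) (volume.prod volume) := by
    rw [integrable_prod_iff]
    · constructor
      · exact ae_of_all _ fun w => (hf.integrable hb w).const_mul (h w)
      · have e : (fun s => ∫ r, ‖Function.uncurry φ (s, r)‖) =
            fun s => |h s| * KK b (fun y => |f y|) s := by
          ext w
          unfold KK
          rw [← integral_const_mul]
          congr 1; ext y
          simp only [Function.uncurry_apply_pair, φ]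
          rw [norm_mul, norm_mul, Real.norm_of_nonneg (kk_nonneg _ _), Real.norm_eq_abs, Real.norm_eq_abs]
        rw [e]
        exact hh.abs.int_mul_KK hb hb1 hf.abs
    · have hm : AEStronglyMeasurable (fun p : ℝ × ℝ => f p.2) (volume.prod volume) := hf.meas.comp_snd
      have hm1 : AEStronglyMeasurable (fun p : ℝ × ℝ => h p.1) (volume.prod volume) := hh.meas.comp_fst
      refine hm1.mul (AEStronglyMeasurable.mul ?_ hm)
      apply Measurable.aestronglyMeasurable
      exact hkm.comp (by fun_prop)
  have := integral_integral_swap hφ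
  have e1 : ∀ s, ∫ r, φ s r = h s * KK b f s := fun s => by
    simp only [φ]; rw [integral_const_mul]; rfl
  have e2 : ∀ r, ∫ s, φ s r = f r * KK b h r := fun r => by
    simp only [φ, KK]; rw [← integral_const_mul]; congr 1; ext s
    rw [show s - r = -(r - s) by ring, kk_neg]; ring
  simpa only [e1, e2] using this

structure Sol (b c T : ℝ) (g : ℝ → ℝ) : Prop where
  T0 : 0 < T
  cont : ContinuousOn g (Icc 0 T)
  eq : ∀ s ∈ Icc (0:ℝ) T, g s + c * ∫ r in (0:ℝ)..T, kk b (s - r) * g r = 1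

noncomputable def ex (T : ℝ) (g : ℝ → ℝ) : ℝ → ℝ := (Icc 0 T).indicator g

lemma ex_in {T : ℝ} {g : ℝ → ℝ} {y : ℝ} (h : y ∈ Icc 0 T) : ex T g y = g y := indicator_of_mem h _
lemma ex_out {T : ℝ} {g : ℝ → ℝ} {y : ℝ} (h : y ∉ Icc 0 T) : ex T g y = 0 := indicator_of_notMem h _

lemma KK_ex {b T : ℝ} {g : ℝ → ℝ} (hT : 0 ≤ T) (x : ℝ) :
    KK b (ex T g) x = ∫ r in (0:ℝ)..T, kk b (x - r) * g r := by
  rw [intervalIntegral.integral_of_le hT, ← integral_Icc_eq_integral_Ioc, ← integral_indicator measurableSet_Icc]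
  unfold KK ex
  congr 1; ext y
  by_cases h : y ∈ Icc 0 T <;> simp [h]

lemma int_ex {T : ℝ} {g : ℝ → ℝ} (hT : 0 ≤ T) :
    ∫ y, ex T g y = ∫ r in (0:ℝ)..T, g r := by
  rw [intervalIntegral.integral_of_le hT, ← integral_Icc_eq_integral_Ioc, ← integral_indicator measurableSet_Icc]
  rfl

section
variable {b c T : ℝ} {g : ℝ → ℝ}

lemma Sol.eq' (h : Sol b c T g) {s : ℝ} (hs : s ∈ Icc 0 T) : ex T g s = 1 - c * KK b (ex T g) s := by
  rw [KK_ex h.T0.le, ex_in hs]; linarith [h.eq s hs]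

lemma Sol.nice0 (h : Sol b c T g) : ∃ M, Nice T M (ex T g) := by
  obtain ⟨M, hM⟩ := isCompact_Icc.exists_bound_of_continuousOn h.cont
  have hM0 : 0 ≤ M := (norm_nonneg _).trans (hM 0 ⟨le_rfl, h.T0.le⟩)
  refine ⟨M, ?_, fun y => ?_, fun y hy => ex_out hy, h.T0.le⟩
  · exact (aestronglyMeasurable_indicator_iff measurableSet_Icc).2 (h.cont.aestronglyMeasurable measurableSet_Icc)
  · by_cases hy : y ∈ Icc 0 T
    · rw [ex_in hy]; exact hM y hy
    · rw [ex_out hy]; simpa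

lemma Sol.nonneg (hb : 0 < b) (hb1 : b < 1) (hc : 0 < c) (h : Sol b c T g) (y : ℝ) : 0 ≤ ex T g y := by
  obtain ⟨M, hM⟩ := h.nice0
  by_cases hy : y ∈ Icc 0 T
  · have := max_principle' hb hb1 hM (t := 1 / c) (by positivity) (fun z hz => by
      by_cases hz' : z ∈ Icc 0 T
      · rw [h.eq' hz']
        rw [div_lt_iff₀ hc] at hz
        linarith
      · rw [ex_out hz']) y
    rw [h.eq' hy]
    rw [le_div_iff₀ hc] at this
    linarith
  · rw [ex_out hy]

lemma KK_nonneg {f : ℝ → ℝ} (hf : ∀ y, 0 ≤ f y) (x : ℝ) : 0 ≤ KK b f x :=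
  integral_nonneg fun y => mul_nonneg (kk_nonneg _ _) (hf y)

lemma Sol.nice (hb : 0 < b) (hb1 : b < 1) (hc : 0 < c) (h : Sol b c T g) : Nice T 1 (ex T g) := by
  obtain ⟨M, hM⟩ := h.nice0
  have h0 := h.nonneg hb hb1 hc
  refine ⟨hM.meas, fun y => ?_, hM.supp, hM.L0⟩
  rw [abs_of_nonneg (h0 y)]
  by_cases hy : y ∈ Icc 0 T
  · rw [h.eq' hy]
    have := mul_nonneg hc.le (KK_nonneg (b := b) h0 y)
    linarith
  · rw [ex_out hy]; norm_num

lemma Sol.mono (hb : 0 < b) (hb1 : b < 1) (hc : 0 < c) (h : Sol b c T g) {T' : ℝ} {g' : ℝ → ℝ}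
    (h' : Sol b c T' g') (hT : T ≤ T') (x : ℝ) : KK b (ex T g) x ≤ KK b (ex T' g') x := by
  have n := h.nice hb hb1 hc
  have n' := h'.nice hb hb1 hc
  have := max_principle' hb hb1 (n.sub n' hT) (t := 0) le_rfl (fun z hz => by
    rw [KK_sub hb n n'] at hz
    by_cases hz' : z ∈ Icc 0 T
    · rw [h.eq' hz', h'.eq' ⟨hz'.1, hz'.2.trans hT⟩]
      nlinarith
    · rw [ex_out hz']
      linarith [h'.nonneg hb hb1 hc z]) x
  rw [KK_sub hb n n'] at this
  linarith

lemma Sol.increment (hb : 0 < b) (hb1 : b < 1) (hc : 0 < c) (h : Sol b c T g) {T' : ℝ} {g' : ℝ → ℝ}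
    (h' : Sol b c T' g') (hT : T ≤ T') :
    (∫ r in (0:ℝ)..T', g' r) - ∫ r in (0:ℝ)..T, g r =
      ∫ s in T..T', ex T' g' s * (1 - c * KK b (ex T g) s) := by
  have n := h.nice hb hb1 hc
  have n' := h'.nice hb hb1 hc
  rw [← int_ex h.T0.le, ← int_ex h'.T0.le]
  set f := ex T g
  set f' := ex T' g'
  have e1 : ∫ y, f y = ∫ y, (f y * f' y + c * (f y * KK b f' y)) := by
    congr 1; ext y
    by_cases hy : y ∈ Icc 0 T
    · have := h'.eq' (s := y) ⟨hy.1, hy.2.trans hT⟩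
      change f' y = 1 - c * KK b f' y at this
      rw [this]; ring
    · rw [show f y = 0 from ex_out hy]; ring
  rw [integral_add (n.int_mul n') ((n.int_mul_KK hb hb1 n').const_mul c), integral_const_mul,
    ← KK_symm hb hb1 n n', ← integral_const_mul] at e1
  have i1 := n.int_mul n'
  have i2 := (n'.int_mul_KK hb hb1 n).const_mul c
  have i3 : Integrable (fun y => f y * f' y + c * (f' y * KK b f y)) := i1.add i2
  rw [e1, ← integral_add i1 i2, ← integral_sub n'.int i3, intervalIntegral.integral_of_le hT,
    ← integral_indicator measurableSet_Ioc]
  congr 1; ext y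
  by_cases hy : y ∈ Ioc T T'
  · rw [indicator_of_mem hy]
    have : f y = 0 := ex_out (fun h => absurd h.2 (not_le.2 hy.1))
    rw [this]; ring
  · rw [indicator_of_notMem hy]
    by_cases hy1 : y ∈ Icc 0 T
    · have : f y = 1 - c * KK b f y := h.eq' hy1
      rw [this]; ring
    · have : f' y = 0 := ex_out (fun h => by
        by_cases hz : y ≤ T
        · exact hy1 ⟨h.1, hz⟩
        · exact hy ⟨not_le.1 hz, h.2⟩)
      rw [this]; ring

lemma Sol.upper (hb : 0 < b) (hb1 : b < 1) (hc : 0 < c) (h : Sol b c T g) {T' : ℝ} {g' : ℝ → ℝ}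
    (h' : Sol b c T' g') (hT : T ≤ T') :
    (∫ r in (0:ℝ)..T', g' r) - ∫ r in (0:ℝ)..T, g r ≤ (T' - T) * (g T + c * (4 / b) * (T' - T) ^ b) ^ 2 := by
  have n := h.nice hb hb1 hc
  have n' := h'.nice hb hb1 hc
  rw [h.increment hb hb1 hc h' hT]
  have hcon := n.cont hb hb1
  have hi : IntervalIntegrable (fun s => ex T' g' s * (1 - c * KK b (ex T g) s)) volume T T' := by
    apply Integrable.intervalIntegrable
    have := n'.int.sub ((n'.int_mul_KK hb hb1 n).const_mul c)
    refine this.congr (ae_of_all _ fun y => ?_)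
    simp only [Pi.sub_apply]; ring
  calc _ ≤ ∫ s in T..T', (g T + c * (4 / b) * (T' - T) ^ b) ^ 2 := by
        apply intervalIntegral.integral_mono_on hT hi (by simp)
        intro s hs
        have e1 : ex T' g' s = 1 - c * KK b (ex T' g') s := h'.eq' ⟨h.T0.le.trans hs.1, hs.2⟩
        have e2 : g T = 1 - c * KK b (ex T g) T := by
          rw [← h.eq' ⟨h.T0.le, le_rfl⟩, ex_in ⟨h.T0.le, le_rfl⟩]
        have m := mul_le_mul_of_nonneg_left (h.mono hb hb1 hc h' hT s) hc.le
        have p := h'.nonneg hb hb1 hc s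
        have hh := (le_abs_self _).trans (n.holder hb hb1 T s)
        have hh2 : |T - s| ^ b ≤ (T' - T) ^ b := by
          apply Real.rpow_le_rpow (abs_nonneg _) _ hb.le
          rw [abs_sub_comm, abs_of_nonneg (by linarith [hs.1])]; linarith [hs.2]
        have hh3 : 4 * 1 / b * |T - s| ^ b ≤ 4 / b * (T' - T) ^ b := by
          rw [mul_one]; gcongr
        have hh4 := mul_le_mul_of_nonneg_left (hh.trans hh3) hc.le
        have a1 : ex T' g' s ≤ 1 - c * KK b (ex T g) s := by linarith
        have a2 : 1 - c * KK b (ex T g) s ≤ g T + c * (4 / b) * (T' - T) ^ b := by linarith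
        rw [sq]
        apply mul_le_mul (a1.trans a2) a2 (p.trans a1) (p.trans (a1.trans a2))
    _ = _ := by simp

lemma Sol.lower (hb : 0 < b) (hb1 : b < 1) (hc : 0 < c) (h : Sol b c T g) {T' : ℝ} {g' : ℝ → ℝ}
    (h' : Sol b c T' g') (hT : T ≤ T') :
    (T' - T) * (max 0 (g' T' - c * (4 / b) * (T' - T) ^ b)) ^ 2 ≤ 
    (∫ r in (0:ℝ)..T', g' r) - ∫ r in (0:ℝ)..T, g r := by
  have n := h.nice hb hb1 hc
  have n' := h'.nice hb hb1 hc
  rw [h.increment hb hb1 hc h' hT]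
  have hcon := n.cont hb hb1
  have hi : IntervalIntegrable (fun s => ex T' g' s * (1 - c * KK b (ex T g) s)) volume T T' := by
    apply Integrable.intervalIntegrable
    have := n'.int.sub ((n'.int_mul_KK hb hb1 n).const_mul c)
    refine this.congr (ae_of_all _ fun y => ?_)
    simp only [Pi.sub_apply]; ring
  calc _ = ∫ s in T..T', (max 0 (g' T' - c * (4 / b) * (T' - T) ^ b)) ^ 2 := by simp
    _ ≤ _ := by
        apply intervalIntegral.integral_mono_on hT (by simp) hi
        intro s hs
        have e1 : ex T' g' s = 1 - c * KK b (ex T' g') s := h'.eq' ⟨h.T0.le.trans hs.1, hs.2⟩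
        have e2 : g' T' = 1 - c * KK b (ex T' g') T' := by
          rw [← h'.eq' ⟨h'.T0.le, le_rfl⟩, ex_in ⟨h'.T0.le, le_rfl⟩]
        have m := mul_le_mul_of_nonneg_left (h.mono hb hb1 hc h' hT s) hc.le
        have p := h'.nonneg hb hb1 hc s
        have hh := (le_abs_self _).trans (n'.holder hb hb1 s T')
        have hh2 : |s - T'| ^ b ≤ (T' - T) ^ b := by
          apply Real.rpow_le_rpow (abs_nonneg _) _ hb.le
          rw [abs_sub_comm, abs_of_nonneg (by linarith [hs.2])]; linarith [hs.1]
        have hh3 : 4 * 1 / b * |s - T'| ^ b ≤ 4 / b * (T' - T) ^ b := by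
          rw [mul_one]; gcongr
        have hh4 := mul_le_mul_of_nonneg_left (hh.trans hh3) hc.le
        have a1 : ex T' g' s ≤ 1 - c * KK b (ex T g) s := by linarith
        have a2 : max 0 (g' T' - c * (4 / b) * (T' - T) ^ b) ≤ ex T' g' s := max_le p (by linarith)
        have a0 := le_max_left 0 (g' T' - c * (4 / b) * (T' - T) ^ b)
        rw [sq]
        apply mul_le_mul a2 (a2.trans a1) a0 p
  
lemma Sol.pair (hb : 0 < b) (hb1 : b < 1) (hc : 0 < c) (h : Sol b c T g) {c' : ℝ} {v : ℝ → ℝ}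
    (hcc : c ≤ c') (h' : Sol b c' T v) :
    c * ∫ r in (0:ℝ)..T, g r ≤ c' * ∫ r in (0:ℝ)..T, v r := by
  have hc' : 0 < c' := by linarith
  have n := h.nice hb hb1 hc
  have n' := h'.nice hb hb1 hc'
  rw [← int_ex h.T0.le, ← int_ex h.T0.le]
  have pn := h.nonneg hb hb1 hc
  have pn' := h'.nonneg hb hb1 hc'
  set f := ex T g
  set f' := ex T v
  have e1 : ∫ y, f y = ∫ y, (f y * f' y + c' * (f y * KK b f' y)) := by
    congr 1; ext y
    by_cases hy : y ∈ Icc 0 T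
    · have := h'.eq' (s := y) hy
      change f' y = 1 - c' * KK b f' y at this
      rw [this]; ring
    · rw [show f y = 0 from ex_out hy]; ring
  have e2 : ∫ y, f' y = ∫ y, (f y * f' y + c * (f' y * KK b f y)) := by
    congr 1; ext y
    by_cases hy : y ∈ Icc 0 T
    · have := h.eq' (s := y) hy
      change f y = 1 - c * KK b f y at this
      rw [this]; ring
    · rw [show f' y = 0 from ex_out hy]; ring
  rw [integral_add (n.int_mul n') ((n.int_mul_KK hb hb1 n').const_mul c'), integral_const_mul] at e1
  rw [integral_add (n.int_mul n') ((n'.int_mul_KK hb hb1 n).const_mul c), integral_const_mul,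
    KK_symm hb hb1 n n'] at e2
  have hD : 0 ≤ ∫ y, f y * f' y := integral_nonneg fun y => mul_nonneg (pn y) (pn' y)
  rw [e1, e2]
  nlinarith

lemma Sol.Fbound (hb : 0 < b) (hb1 : b < 1) (hc : 0 < c) (h : Sol b c T g) :
    T ^ (b - 1) * ∫ r in (0:ℝ)..T, g r ≤ 1 / c := by
  have n := h.nice hb hb1 hc
  rw [← int_ex h.T0.le]
  have pn := h.nonneg hb hb1 hc
  set f := ex T g
  have hT := h.T0
  set F := ∫ y, f y with hF
  have hF0 : 0 ≤ F := integral_nonneg pn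
  have hK : ∀ s ∈ Icc 0 T, T ^ (b - 1) * F ≤ KK b f s := by
    intro s hs
    rw [hF, ← integral_const_mul]
    unfold KK
    apply integral_mono_ae (n.int.const_mul _) (n.integrable hb s)
    have hne : ∀ᵐ w : ℝ, w ≠ s := by simp [ae_iff]
    filter_upwards [hne] with y hy
    by_cases hyT : y ∈ Icc 0 T
    · apply mul_le_mul_of_nonneg_right _ (pn y)
      have := kk_anti hb1 (x := s - y) (y := T) (sub_ne_zero.2 hy.symm) (by
        rw [abs_of_pos hT, abs_le]; constructor <;> linarith [hs.1, hs.2, hyT.1, hyT.2])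
      rwa [kk, abs_of_pos hT] at this
    · rw [show f y = 0 from ex_out hyT]; simp
  have h1 : ∫ y, c * (T ^ (b-1) * F) * f y ≤ F := by
    rw [hF]
    apply integral_mono (n.int.const_mul _) n.int
    intro y
    by_cases hy : y ∈ Icc 0 T
    · have e := h.eq' (s := y) hy
      change f y = 1 - c * KK b f y at e
      have := mul_le_mul_of_nonneg_left (hK y hy) hc.le
      have h3 : c * (T ^ (b-1) * F) ≤ 1 := by linarith [pn y]
      have := mul_le_mul_of_nonneg_right h3 (pn y)
      simpa using this
    · simp [show f y = 0 from ex_out hy]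
  rw [integral_const_mul] at h1
  change c * (T ^ (b-1) * F) * F ≤ F at h1
  rw [le_div_iff₀ hc]
  rcases hF0.eq_or_lt with h0 | h0
  · rw [← h0]; simp
  · by_contra hcon
    push Not at hcon
    nlinarith

lemma Sol.Fpos (hb : 0 < b) (hb1 : b < 1) (hc : 0 < c) (h : Sol b c T g) :
    0 < ∫ r in (0:ℝ)..T, g r := by
  have pn : ∀ y ∈ Icc 0 T, 0 ≤ g y := fun y hy => by
    have := h.nonneg hb hb1 hc y; rwa [ex_in hy] at this
  apply intervalIntegral.integral_pos h.T0 h.cont (fun y hy => pn y ⟨hy.1.le, hy.2⟩)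
  by_contra hcon
  push Not at hcon
  have hz : ∀ y ∈ Icc 0 T, g y = 0 := fun y hy => le_antisymm (hcon y hy) (pn y hy)
  have e := h.eq 0 ⟨le_rfl, h.T0.le⟩
  have : ∫ r in (0:ℝ)..T, kk b (0 - r) * g r = ∫ r in (0:ℝ)..T, 0 := by
    apply intervalIntegral.integral_congr
    intro r hr
    rw [uIcc_of_le h.T0.le] at hr
    simp [hz r hr]
  rw [this, hz 0 ⟨le_rfl, h.T0.le⟩] at e
  simp at e

lemma Sol.scale (h : Sol b c T g) {l T1 : ℝ} (hl : 0 < l) (hT : T = l * T1) :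
    Sol b (c * l ^ b) T1 (fun s => g (l * s)) := by
  have hT1 : 0 < T1 := by
    have := h.T0; rw [hT] at this; exact (pos_iff_pos_of_mul_pos this).1 hl
  have hm : ∀ s ∈ Icc 0 T1, l * s ∈ Icc 0 T := fun s hs =>
    ⟨mul_nonneg hl.le hs.1, by rw [hT]; exact mul_le_mul_of_nonneg_left hs.2 hl.le⟩
  refine ⟨hT1, h.cont.comp (by fun_prop) hm, fun s hs => ?_⟩
  have e := h.eq (l * s) (hm s hs)
  have := intervalIntegral.mul_integral_comp_mul_left (a := 0) (b := T1)
    (f := fun r => kk b (l * s - r) * g r) l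
  rw [mul_zero, ← hT] at this
  rw [← this] at e
  have e2 : ∫ r in (0:ℝ)..T1, kk b (l * s - l * r) * g (l * r) = 
    l ^ (b - 1) * ∫ r in (0:ℝ)..T1, kk b (s - r) * g (l * r) := by
    rw [← intervalIntegral.integral_const_mul]
    congr 1; ext r
    rw [← mul_sub, kk_mul]
    rw [show kk b l = l ^ (b - 1) by rw [kk, abs_of_pos hl]]; ring
  rw [e2] at e
  rw [← e, Real.rpow_sub_one hl.ne']
  field_simp

end

lemma sum_up {b C : ℝ} (hb : 0 < b) (hC : 0 ≤ C) {F e : ℝ → ℝ} (he : ∀ T T', 0 < T → T ≤ T' → e T' ≤ e T)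
    (he0 : ∀ T, 0 < T → 0 ≤ e T)
    (hF : ∀ T T', 0 < T → T ≤ T' → F T' - F T ≤ (T' - T) * (e T + C * (T' - T) ^ b) ^ 2)
    {T a : ℝ} (hT : 0 < T) (ha : 0 ≤ a) : F (T + a) - F T ≤ a * e T ^ 2 := by
  have key : ∀ n : ℕ, F (T + a) - F T ≤ a * (e T + C * (a / (n + 1 : ℝ)) ^ b) ^ 2 := by
    intro n
    set h := a / (n + 1 : ℝ) with hh
    have hh0 : 0 ≤ h := by positivity
    have ind : ∀ k : ℕ, F (T + k * h) - F T ≤ k * (h * (e T + C * h ^ b) ^ 2) := by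
      intro k
      induction k with
      | zero => simp
      | succ k ih =>
        have hk : 0 ≤ k * h := by positivity
        have h1 := hF (T + k * h) (T + (k + 1) * h) (by linarith) (by linarith)
        rw [show T + (k + 1) * h - (T + k * h) = h by ring] at h1
        have h2 := he T (T + k * h) hT (by linarith)
        have h3 := he0 (T + k * h) (by linarith)
        have h4 : h * (e (T + k * h) + C * h ^ b) ^ 2 ≤ h * (e T + C * h ^ b) ^ 2 := by gcongr
        push_cast
        linarith
    have := ind (n + 1)
    have e1 : ((n + 1 : ℕ) : ℝ) * h = a := by rw [hh]; push_cast; field_simp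
    rw [← mul_assoc, e1] at this
    exact this
  have lim : Tendsto (fun n : ℕ => a * (e T + C * (a / (n + 1 : ℝ)) ^ b) ^ 2) atTop
      (nhds (a * (e T + C * 0 ^ b) ^ 2)) := by
    have h1 : Tendsto (fun n : ℕ => a / (n + 1 : ℝ)) atTop (nhds 0) := by
      have := (tendsto_one_div_add_atTop_nhds_zero_nat (𝕜 := ℝ)).const_mul a
      simpa [div_eq_mul_inv] using this
    have h2 := (Real.continuous_rpow_const hb.le).tendsto (0:ℝ)
    exact (((h2.comp h1).const_mul C).const_add (e T)).pow 2 |>.const_mul a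
  rw [Real.zero_rpow hb.ne', mul_zero, add_zero] at lim
  exact ge_of_tendsto' lim key

lemma sum_lo {b C : ℝ} (hb : 0 < b) {F e : ℝ → ℝ} (he : ∀ T T', 0 < T → T ≤ T' → e T' ≤ e T)
    (he0 : ∀ T, 0 < T → 0 ≤ e T)
    (hF : ∀ T T', 0 < T → T ≤ T' → (T' - T) * (max 0 (e T' - C * (T' - T) ^ b)) ^ 2 ≤ F T' - F T)
    {T a : ℝ} (hT : 0 < T) (ha : 0 ≤ a) : a * e (T + a) ^ 2 ≤ F (T + a) - F T := by
  have key : ∀ n : ℕ, a * (max 0 (e (T + a) - C * (a / (n + 1 : ℝ)) ^ b)) ^ 2 ≤ F (T + a) - F T := by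
    intro n
    set h := a / (n + 1 : ℝ) with hh
    have hh0 : 0 ≤ h := by positivity
    have e1 : ((n : ℝ) + 1) * h = a := by rw [hh]; field_simp
    have ind : ∀ k : ℕ, k ≤ n + 1 → k * (h * (max 0 (e (T + a) - C * h ^ b)) ^ 2) ≤ F (T + k * h) - F T := by
      intro k
      induction k with
      | zero => simp
      | succ k ih =>
        intro hkn
        have ih := ih (by omega)
        have hk : 0 ≤ k * h := by positivity
        have h1 := hF (T + k * h) (T + (k + 1) * h) (by linarith) (by linarith)
        rw [show T + (k + 1) * h - (T + k * h) = h by ring] at h1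
        have hka : (k + 1) * h ≤ a := by
          rw [← e1]
          apply mul_le_mul_of_nonneg_right _ hh0
          exact_mod_cast hkn
        have h2 := he (T + (k+1) * h) (T + a) (by linarith) (by linarith)
        have h4 : h * (max 0 (e (T + a) - C * h ^ b)) ^ 2 ≤ h * (max 0 (e (T + (k+1) * h) - C * h ^ b)) ^ 2 := by
          gcongr
        push_cast
        linarith
    have := ind (n + 1) le_rfl
    push_cast at this
    rw [← mul_assoc, e1] at this
    exact this
  have lim : Tendsto (fun n : ℕ => a * (max 0 (e (T + a) - C * (a / (n + 1 : ℝ)) ^ b)) ^ 2) atTop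
      (nhds (a * (max 0 (e (T + a) - C * 0 ^ b)) ^ 2)) := by
    have h1 : Tendsto (fun n : ℕ => a / (n + 1 : ℝ)) atTop (nhds 0) := by
      have := (tendsto_one_div_add_atTop_nhds_zero_nat (𝕜 := ℝ)).const_mul a
      simpa [div_eq_mul_inv] using this
    have h2 := (Real.continuous_rpow_const hb.le).tendsto (0:ℝ)
    exact (tendsto_const_nhds.max (((h2.comp h1).const_mul C).const_sub (e (T + a)))).pow 2 |>.const_mul a
  rw [Real.zero_rpow hb.ne', mul_zero, sub_zero, max_eq_right (he0 _ (by linarith))] at lim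
  exact le_of_tendsto' lim key

/-- monotone density -/
lemma mono_density {b lam : ℝ} {F E : ℝ → ℝ}
    (hup : ∀ T a, 0 < T → 0 ≤ a → F (T + a) - F T ≤ a * E T)
    (hlo : ∀ T a, 0 < T → 0 ≤ a → a * E (T + a) ≤ F (T + a) - F T)
    (hQ : Tendsto (fun T => T ^ (b - 1) * F T) atTop (nhds lam)) :
    Tendsto (fun T => T ^ b * E T) atTop (nhds (lam * (1 - b))) := by
  -- the comparison function
  let R : ℝ → ℝ → ℝ := fun θ T => ((T ^ (b - 1) * F T) - θ ^ (1 - b) * ((θ * T) ^ (b - 1) * F (θ * T))) / (1 - θ)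
  have hR : ∀ θ, 0 < θ → Tendsto (R θ) atTop (nhds (lam * ((1 - θ ^ (1 - b)) / (1 - θ)))) := by
    intro θ hθ
    have h1 : Tendsto (fun T => (θ * T) ^ (b - 1) * F (θ * T)) atTop (nhds lam) :=
      hQ.comp (tendsto_id.const_mul_atTop hθ)
    have := (hQ.sub (h1.const_mul (θ ^ (1 - b)))).div_const (1 - θ)
    convert this using 2; ring
  have hRe : ∀ θ T, 0 < θ → 0 < T → R θ T = T ^ (b - 1) * (F T - F (θ * T)) / (1 - θ) := by
    intro θ T hθ hT
    simp only [R]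
    congr 1
    rw [Real.mul_rpow hθ.le hT.le]
    have : θ ^ (1 - b) * θ ^ (b - 1) = 1 := by rw [← Real.rpow_add hθ]; simp
    linear_combination (-(T ^ (b-1) * F (θ * T))) * this
  have hTb : ∀ T : ℝ, 0 < T → T ^ b = T ^ (b - 1) * T := fun T hT => by
    rw [Real.rpow_sub_one hT.ne']; field_simp
  have hupper : ∀ θ T, 0 < θ → θ < 1 → 0 < T → T ^ b * E T ≤ R θ T := by
    intro θ T hθ hθ1 hT
    rw [hRe θ T hθ hT, le_div_iff₀ (by linarith), hTb T hT]
    have h1 := hlo (θ * T) ((1 - θ) * T) (by positivity) (mul_nonneg (by linarith) hT.le)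
    rw [show θ * T + (1 - θ) * T = T by ring] at h1
    have := mul_le_mul_of_nonneg_left h1 (Real.rpow_nonneg hT.le (b - 1))
    linarith
  have hlower : ∀ θ T, 1 < θ → 0 < T → R θ T ≤ T ^ b * E T := by
    intro θ T hθ1 hT
    have hθ : 0 < θ := by linarith
    rw [hRe θ T hθ hT, div_le_iff_of_neg (by linarith), hTb T hT]
    have h1 := hup T ((θ - 1) * T) hT (mul_nonneg (by linarith) hT.le)
    rw [show T + (θ - 1) * T = θ * T by ring] at h1
    have := mul_le_mul_of_nonneg_left h1 (Real.rpow_nonneg hT.le (b - 1))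
    linarith
  have hder : Tendsto (fun θ : ℝ => lam * ((1 - θ ^ (1 - b)) / (1 - θ))) (nhdsWithin 1 {1}ᶜ)
      (nhds (lam * (1 - b))) := by
    have h1 := Real.hasDerivAt_rpow_const (x := 1) (p := 1 - b) (Or.inl one_ne_zero)
    rw [hasDerivAt_iff_tendsto_slope] at h1
    simp only [Real.one_rpow, mul_one] at h1
    refine (h1.congr fun θ => ?_).const_mul lam
    rw [slope_def_field, Real.one_rpow, ← neg_sub (1:ℝ) (θ ^ (1-b)), ← neg_sub (1:ℝ) θ, neg_div_neg_eq]
  rw [tendsto_order]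
  constructor
  · intro a ha
    have h1 : ∀ᶠ θ in nhdsWithin (1:ℝ) (Ioi 1), a < lam * ((1 - θ ^ (1 - b)) / (1 - θ)) :=
      (hder.mono_left (nhdsWithin_mono _ (fun x (hx : 1 < x) => ne_of_gt hx))).eventually_const_lt ha
    obtain ⟨θ, hθ, hθ1⟩ := (h1.and self_mem_nhdsWithin).exists
    have hθ1 : 1 < θ := hθ1
    filter_upwards [(hR θ (by linarith)).eventually_const_lt hθ, eventually_gt_atTop 0] with T h2 h3
    exact h2.trans_le (hlower θ T hθ1 h3)
  · intro a ha
    have h1 : ∀ᶠ θ in nhdsWithin (1:ℝ) (Iio 1), lam * ((1 - θ ^ (1 - b)) / (1 - θ)) < a :=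
      (hder.mono_left (nhdsWithin_mono _ (fun x (hx : x < 1) => ne_of_lt hx))).eventually_lt_const ha
    have h0 : ∀ᶠ θ in nhdsWithin (1:ℝ) (Iio 1), 0 < θ :=
      (eventually_gt_nhds one_pos).filter_mono nhdsWithin_le_nhds
    obtain ⟨θ, ⟨hθ, hθ0⟩, hθ1⟩ := ((h1.and h0).and self_mem_nhdsWithin).exists
    have hθ1 : θ < 1 := hθ1
    filter_upwards [(hR θ hθ0).eventually_lt_const hθ, eventually_gt_atTop 0] with T h2 h3
    exact (hupper θ T hθ0 hθ1 h3).trans_lt h2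

lemma Q_lim {b c : ℝ} (hb : 0 < b) (hb1 : b < 1) (hc : 0 < c) {g : ℝ → ℝ → ℝ}
    (hs : ∀ T, 0 < T → Sol b c T (g T)) :
    ∃ lam, 0 < lam ∧ Tendsto (fun T => T ^ (b - 1) * ∫ r in (0:ℝ)..T, g T r) atTop (nhds lam) := by
  set Q : ℝ → ℝ := fun T => T ^ (b - 1) * ∫ r in (0:ℝ)..T, g T r with hQ
  have hmono : ∀ T T', 0 < T → T ≤ T' → Q T ≤ Q T' := by
    intro T T' hT hTT
    have hT' : 0 < T' := by linarith
    set l := T' / T with hl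
    have hl0 : 0 < l := by positivity
    have hl1 : 1 ≤ l := by rw [hl, one_le_div hT]; exact hTT
    have e1 : T' = l * T := by rw [hl]; field_simp
    have h1 := (hs T' hT').scale hl0 e1
    have hlb : 1 ≤ l ^ b := Real.one_le_rpow hl1 hb.le
    have h2 := (hs T hT).pair hb hb1 hc (c' := c * l ^ b) (by nlinarith) h1
    have h3 := intervalIntegral.mul_integral_comp_mul_left (a := 0) (b := T) (f := g T') l
    rw [mul_zero, ← e1] at h3
    simp only [hQ]
    rw [← h3]
    have h4 : T' ^ (b - 1) * l = T ^ (b - 1) * l ^ b := by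
      rw [e1, Real.mul_rpow hl0.le hT.le, Real.rpow_sub_one hl0.ne']
      field_simp
    rw [← mul_assoc, h4, mul_assoc]
    apply mul_le_mul_of_nonneg_left _ (by positivity)
    rw [mul_assoc] at h2
    exact le_of_mul_le_mul_left h2 hc
  let Q' : ℝ → ℝ := fun T => Q (max 1 T)
  have hm' : Monotone Q' := fun x y hxy => hmono _ _ (by positivity) (max_le_max le_rfl hxy)
  have hbd : BddAbove (range Q') := by
    refine ⟨1 / c, ?_⟩
    rintro _ ⟨T, rfl⟩
    exact (hs (max 1 T) (by positivity)).Fbound hb hb1 hc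
  have hlim := tendsto_atTop_ciSup hm' hbd
  refine ⟨⨆ i, Q' i, ?_, hlim.congr' ?_⟩
  · refine lt_of_lt_of_le ?_ (le_ciSup hbd 1)
    have := (hs 1 one_pos).Fpos hb hb1 hc
    simpa [Q', hQ] using this
  · filter_upwards [eventually_ge_atTop 1] with T hT
    simp only [Q', max_eq_right hT]

lemma main_asymp {b c : ℝ} (hb : 0 < b) (hb1 : b < 1) (hc : 0 < c) {g : ℝ → ℝ → ℝ}
    (hs : ∀ T, 0 < T → Sol b c T (g T)) (hsymm : ∀ T, 0 < T → g T T = g T 0) :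
    ∃ κ : ℝ, 0 < κ ∧ Tendsto (fun T : ℝ => T ^ b * (g T T) ^ 2) atTop (nhds κ) := by
  obtain ⟨lam, hlam, hlim⟩ := Q_lim hb hb1 hc hs
  have he0 : ∀ T, 0 < T → 0 ≤ g T T := fun T hT => by
    have := (hs T hT).nonneg hb hb1 hc T
    rwa [ex_in ⟨hT.le, le_rfl⟩] at this
  have he : ∀ T T', 0 < T → T ≤ T' → g T' T' ≤ g T T := by
    intro T T' hT hTT
    have hT' : 0 < T' := by linarith
    rw [hsymm T hT, hsymm T' hT']
    have m := mul_le_mul_of_nonneg_left ((hs T hT).mono hb hb1 hc (hs T' hT') hTT 0) hc.le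
    have e1 := (hs T hT).eq' (s := 0) ⟨le_rfl, hT.le⟩
    have e2 := (hs T' hT').eq' (s := 0) ⟨le_rfl, hT'.le⟩
    rw [ex_in ⟨le_rfl, hT.le⟩] at e1
    rw [ex_in ⟨le_rfl, hT'.le⟩] at e2
    linarith
  refine ⟨lam * (1 - b), mul_pos hlam (by linarith), ?_⟩
  refine mono_density (F := fun T => ∫ r in (0:ℝ)..T, g T r) (E := fun T => (g T T)^2) ?_ ?_ hlim
  · intro T a hT ha
    exact sum_up (F := fun T => ∫ r in (0:ℝ)..T, g T r) (e := fun T => g T T) (C := c * (4 / b)) hb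
      (by positivity) he he0
      (fun T T' hT hTT => (hs T hT).upper hb hb1 hc (hs T' (by linarith)) hTT) hT ha
  · intro T a hT ha
    exact sum_lo (F := fun T => ∫ r in (0:ℝ)..T, g T r) (e := fun T => g T T) (C := c * (4 / b)) hb
      he he0
      (fun T T' hT hTT => (hs T hT).lower hb hb1 hc (hs T' (by linarith)) hTT) hT ha

/-- for `H ∈ (1/2,1)`, if for every `T > 0` the second-kind equation
`g_T(s) + c_H ∫₀^T |s−r|^{2H−2} g_T(r) dr = 1` has a (unique) continuous solution on
`[0,T]`, then `T^{2H−1} g_T(T)² → κ_H ∈ (0,∞)` as `T → ∞`, i.e. `g_T(T)²` is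
asymptotically proportional to `T^{1−2H}`. -/
theorem stmt_8 (H : ℝ) (hH : H ∈ Set.Ioo (1/2 : ℝ) 1)
    (g : ℝ → ℝ → ℝ)
    (hg_cont : ∀ T > (0:ℝ), ContinuousOn (g T) (Set.Icc 0 T))
    (hg_eq : ∀ T > (0:ℝ), ∀ s ∈ Set.Icc (0:ℝ) T,
      g T s + (H * (2*H - 1)) * ∫ r in (0:ℝ)..T, |s - r| ^ (2*H - 2) * g T r = 1)
    (hg_uniq : ∀ T > (0:ℝ), ∀ h : ℝ → ℝ, ContinuousOn h (Set.Icc 0 T) →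
      (∀ s ∈ Set.Icc (0:ℝ) T,
        h s + (H * (2*H - 1)) * ∫ r in (0:ℝ)..T, |s - r| ^ (2*H - 2) * h r = 1) →
      ∀ s ∈ Set.Icc (0:ℝ) T, h s = g T s) :
    ∃ κ : ℝ, 0 < κ ∧
      Filter.Tendsto (fun T : ℝ => T ^ (2*H - 1) * (g T T) ^ 2) Filter.atTop (nhds κ) := by
  obtain ⟨h1, h2⟩ := hH
  have hb : 0 < 2 * H - 1 := by linarith
  have hk : ∀ x : ℝ, |x| ^ (2 * H - 2) = kk (2 * H - 1) x := fun x => by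
    unfold kk; congr 1; ring
  apply main_asymp hb (by linarith) (c := H * (2 * H - 1)) (mul_pos (by linarith) hb)
  · intro T hT
    refine ⟨hT, hg_cont T hT, fun s hs => ?_⟩
    have := hg_eq T hT s hs
    simpa only [hk] using this
  · intro T hT
    have hm : ∀ s ∈ Icc (0:ℝ) T, T - s ∈ Icc (0:ℝ) T := fun s hs => ⟨by linarith [hs.2], by linarith [hs.1]⟩
    have := hg_uniq T hT (fun s => g T (T - s)) ((hg_cont T hT).comp (by fun_prop) hm) (fun s hs => by
      have e := hg_eq T hT (T - s) (hm s hs)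
      have e2 := intervalIntegral.integral_comp_sub_left (a := 0) (b := T)
        (fun r => |T - s - r| ^ (2*H - 2) * g T r) T
      rw [sub_self, sub_zero] at e2
      rw [← e2] at e
      simp only [show ∀ r, T - s - (T - r) = -(s - r) from fun r => by ring, abs_neg] at e
      exact e) 0 ⟨le_rfl, hT.le⟩
    simpa using this
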